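/- The fibres of μ_ℍ are exactly the orbits of the standard circle action: for all quaternions q₁, q₂ one has μ_ℍ(q₁) = μ_ℍ(q₂) if and only if there exist real numbers a, b with a² + b² = 1 such that q₂ = z * q₁, where z is the quaternion with real part a, i-part b and j,k-parts 0. -/

import Mathlib

open Quaternion

/-- The imaginary quaternion unit `i`. -/
def quatI : ℍ[ℝ] := ⟨0, 1, 0, 0⟩

/-- The complex quaternion `a + b i`. -/
def circQ (a b : ℝ) : ℍ[ℝ] := ⟨a, b, 0, 0⟩

/-- The hyperKähler moment map of the standard circle action on `ℍ`,
`μ_ℍ(q) = (1/2)·(q̄ i q)`. -/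
noncomputable def muH (q : ℍ[ℝ]) : ℍ[ℝ] :=
  (1 / 2 : ℝ) • (star q * quatI * q)

@[simp] theorem quatI_re : quatI.re = 0 := rfl
@[simp] theorem quatI_imI : quatI.imI = 1 := rfl
@[simp] theorem quatI_imJ : quatI.imJ = 0 := rfl
@[simp] theorem quatI_imK : quatI.imK = 0 := rfl

@[simp] theorem circQ_re (a b : ℝ) : (circQ a b).re = a := rfl
@[simp] theorem circQ_imI (a b : ℝ) : (circQ a b).imI = b := rfl
@[simp] theorem circQ_imJ (a b : ℝ) : (circQ a b).imJ = 0 := rfl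
@[simp] theorem circQ_imK (a b : ℝ) : (circQ a b).imK = 0 := rfl

theorem muH_eq_muH_iff (q₁ q₂ : ℍ[ℝ]) :
    muH q₁ = muH q₂ ↔ star q₁ * quatI * q₁ = star q₂ * quatI * q₂ :=
  smul_right_inj (by norm_num)

theorem normSq_circQ (a b : ℝ) : normSq (circQ a b) = a ^ 2 + b ^ 2 := by
  simp [normSq_def']

theorem normSq_star_mul_quatI_mul (q : ℍ[ℝ]) :
    normSq (star q * quatI * q) = normSq q ^ 2 := by
  have h : normSq quatI = 1 := by simp [normSq_def']
  rw [map_mul, map_mul, h, normSq_star]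
  ring

/-- The elements commuting with `i` are the complex quaternions. -/
theorem eq_circQ_of_commute_quatI {w : ℍ[ℝ]} (h : Commute w quatI) :
    w = circQ w.re w.imI := by
  have hJ := congrArg QuaternionAlgebra.imJ h.eq
  have hK := congrArg QuaternionAlgebra.imK h.eq
  simp at hJ hK
  ext <;> simp <;> linarith

theorem star_circQ_mul_quatI_mul_circQ (a b : ℝ) :
    star (circQ a b) * quatI * circQ a b = (a ^ 2 + b ^ 2) • quatI := by
  ext <;> simp <;> ring

theorem normSq_eq_of_muH_eq {q₁ q₂ : ℍ[ℝ]} (h : muH q₁ = muH q₂) :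
    normSq q₁ = normSq q₂ := by
  have h' := congrArg normSq ((muH_eq_muH_iff q₁ q₂).1 h)
  rw [normSq_star_mul_quatI_mul, normSq_star_mul_quatI_mul] at h'
  exact (sq_eq_sq₀ normSq_nonneg normSq_nonneg).1 h'

theorem commute_quatI_of_muH_eq {q₁ q₂ : ℍ[ℝ]} (h : muH q₁ = muH q₂) (hq : q₁ ≠ 0) :
    Commute (q₂ * star q₁) quatI := by
  have hn : normSq q₁ ≠ 0 := normSq_ne_zero.2 hq
  refine smul_right_injective ℍ[ℝ] hn ?_
  calc normSq q₁ • (q₂ * star q₁ * quatI)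
      = q₂ * star q₁ * quatI * (q₁ * star q₁) := by
        rw [self_mul_star, mul_coe_eq_smul]
    _ = q₂ * (star q₁ * quatI * q₁) * star q₁ := by noncomm_ring
    _ = q₂ * star q₂ * (quatI * (q₂ * star q₁)) := by
        rw [(muH_eq_muH_iff q₁ q₂).1 h]; noncomm_ring
    _ = normSq q₁ • (quatI * (q₂ * star q₁)) := by
        rw [self_mul_star, coe_mul_eq_smul, normSq_eq_of_muH_eq h]

/-- The fibres of `μ_ℍ` are exactly the orbits of the standard circle action:
`μ_ℍ(q₁) = μ_ℍ(q₂)` iff `q₂ = z·q₁` for some unit complex number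
`z = a + b i` (with `a² + b² = 1`). -/
theorem stmt6 (q₁ q₂ : ℍ[ℝ]) :
    muH q₁ = muH q₂ ↔
      ∃ a b : ℝ, a ^ 2 + b ^ 2 = 1 ∧ q₂ = circQ a b * q₁ := by
  constructor
  · intro h
    have hN := normSq_eq_of_muH_eq h
    rcases eq_or_ne q₁ 0 with rfl | hq
    · refine ⟨1, 0, by norm_num, ?_⟩
      rw [mul_zero, ← normSq_eq_zero, ← hN, map_zero]
    · have hn : normSq q₁ ≠ 0 := normSq_ne_zero.2 hq
      have hz : Commute (q₂ * q₁⁻¹) quatI := by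
        rw [Quaternion.inv_def, mul_smul_comm]
        exact (commute_quatI_of_muH_eq h hq).smul_left _
      have hc := eq_circQ_of_commute_quatI hz
      refine ⟨(q₂ * q₁⁻¹).re, (q₂ * q₁⁻¹).imI, ?_, ?_⟩
      · rw [← normSq_circQ, ← hc, map_mul, map_inv₀, ← hN, mul_inv_cancel₀ hn]
      · rw [← hc, inv_mul_cancel_right₀ hq]
  · rintro ⟨a, b, hab, rfl⟩
    rw [muH_eq_muH_iff, star_mul]
    calc star q₁ * quatI * q₁
        = star q₁ * (star (circQ a b) * quatI * circQ a b) * q₁ := by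
          rw [star_circQ_mul_quatI_mul_circQ, hab, one_smul]
      _ = _ := by noncomm_ring
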